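/- For every graph G, the pseudoarboricity of G is at most the arboricity of G, and the arboricity of G is at most the pseudoarboricity of G plus 1. -/

import Mathlib

/-- A pseudoforest: every connected component contains at most one cycle, i.e. any two
cycles lying in the same component have the same edge set. -/
def IsPseudoforest {V : Type*} (H : SimpleGraph V) : Prop :=
  ∀ (u v : V) (c : H.Walk u u) (d : H.Walk v v),
    c.IsCycle → d.IsCycle → H.Reachable u v → ∀ e, e ∈ c.edges ↔ e ∈ d.edges

/-- The pseudoarboricity of `G`: the minimum number of pseudoforests needed to cover the
edges of `G`. -/
noncomputable def pseudoarboricity {V : Type*} (G : SimpleGraph V) : ℕ :=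
  sInf {k | ∃ F : Fin k → SimpleGraph V,
    (∀ i, F i ≤ G ∧ IsPseudoforest (F i)) ∧
    ∀ e ∈ G.edgeSet, ∃ i, e ∈ (F i).edgeSet}

/-- The arboricity of `G`: the minimum number of forests needed to cover the edges
of `G`. -/
noncomputable def arboricity {V : Type*} (G : SimpleGraph V) : ℕ :=
  sInf {k | ∃ F : Fin k → SimpleGraph V,
    (∀ i, F i ≤ G ∧ (F i).IsAcyclic) ∧
    ∀ e ∈ G.edgeSet, ∃ i, e ∈ (F i).edgeSet}


open SimpleGraph

section Pseudoforest

variable {V W : Type*}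

theorem SimpleGraph.IsAcyclic.isPseudoforest {H : SimpleGraph V} (hH : H.IsAcyclic) :
    IsPseudoforest H :=
  fun _ _ c _ hc => (hH c hc).elim

theorem IsPseudoforest.comap {H : SimpleGraph V} {H' : SimpleGraph W} (hH : IsPseudoforest H)
    (f : H' →g H) (hf : Function.Injective f) : IsPseudoforest H' := by
  intro u v c d hc hd huv e
  have key := hH _ _ (c.map f) (d.map f) (hc.map hf) (hd.map hf) (huv.map f) (e.map f)
  simpa [Walk.edges_map, List.mem_map_of_injective (Sym2.map.injective hf)] using key

/-- A connected pseudoforest has at most one edge outside a given spanning tree. -/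
theorem IsPseudoforest.subsingleton_edgeSet_diff {H T : SimpleGraph V} (hH : IsPseudoforest H)
    (hT : T.IsTree) (hTH : T ≤ H) : (H.edgeSet \ T.edgeSet).Subsingleton := by
  have hconn : H.Connected := hT.connected.mono hTH
  have hmax := (isTree_iff_maximal_isAcyclic.mp hT).2
  have cycle : ∀ e ∈ H.edgeSet \ T.edgeSet, ∃ (u : V) (c : H.Walk u u), c.IsCycle ∧ e ∈ c.edges ∧
      ∀ x ∈ c.edges, x ∈ T.edgeSet ∨ x = e := by
    intro e he
    have hle : T ⊔ fromEdgeSet {e} ≤ H :=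
      sup_le hTH (H.fromEdgeSet_le.mpr (by grind))
    have hnot : ¬ (T ⊔ fromEdgeSet {e}).IsAcyclic := fun h => he.2 <| by
      have h1 : e ∈ (T ⊔ fromEdgeSet {e}).edgeSet := by
        simp [H.not_isDiag_of_mem_edgeSet he.1]
      exact edgeSet_mono (hmax.2 h le_sup_left) h1
    simp only [IsAcyclic, not_forall, not_not] at hnot
    obtain ⟨u, c, hc⟩ := hnot
    have hsub : ∀ x ∈ c.edges, x ∈ T.edgeSet ∨ x = e := by
      intro x hx
      have := c.edges_subset_edgeSet hx
      simp only [edgeSet_sup, edgeSet_fromEdgeSet] at this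
      grind
    refine ⟨u, c.mapLe hle, hc.mapLe hle, ?_, ?_⟩
    · rw [Walk.edges_mapLe_eq_edges]
      by_contra hec
      exact hT.isAcyclic _ (hc.transfer (H := T) (by grind))
    · simpa [Walk.edges_mapLe_eq_edges] using hsub
  intro e he e' he'
  obtain ⟨u, c, hc, hec, -⟩ := cycle e he
  obtain ⟨v, d, hd, -, hd'⟩ := cycle e' he'
  have := (hH u v c d hc hd (hconn.preconnected u v) e).mp hec
  grind

theorem IsPseudoforest.card_edgeSet_le_of_connected [Finite V] {H : SimpleGraph V}
    (hH : IsPseudoforest H) (hconn : H.Connected) : Nat.card H.edgeSet ≤ Nat.card V := by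
  obtain ⟨T, hTH, hT⟩ := hconn.exists_isTree_le
  have h1 := (isTree_iff_connected_and_card.mp hT).2
  have h2 := Set.ncard_le_one_iff_subsingleton.mpr (hH.subsingleton_edgeSet_diff hT hTH)
  have h3 := Set.ncard_sdiff_add_ncard_of_subset (edgeSet_mono hTH)
  simp only [Nat.card_coe_set_eq] at *
  omega

theorem IsPseudoforest.card_edgeSet_le [Finite V] {H : SimpleGraph V} (hH : IsPseudoforest H) :
    Nat.card H.edgeSet ≤ Nat.card V := by
  have := Fintype.ofFinite H.ConnectedComponent
  have hV : Nat.card V = ∑ C : H.ConnectedComponent, Nat.card C := by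
    rw [← Nat.card_sigma, ← Nat.card_congr (Equiv.sigmaFiberEquiv H.connectedComponentMk)]
    rfl
  let f : (Σ C : H.ConnectedComponent, C.toSimpleGraph.edgeSet) → H.edgeSet :=
    fun x => ⟨x.2.1.map x.1.toSimpleGraph_hom, x.1.toSimpleGraph_hom.map_mem_edgeSet x.2.2⟩
  have hf : Function.Surjective f := by
    rintro ⟨e, he⟩
    induction e with | _ u v =>
    have huv : H.Adj u v := he
    let C := H.connectedComponentMk u
    have hv : v ∈ C := ConnectedComponent.sound huv.symm.reachable
    exact ⟨⟨C, s(⟨u, rfl⟩, ⟨v, hv⟩), huv⟩, rfl⟩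
  calc Nat.card H.edgeSet
      ≤ ∑ C : H.ConnectedComponent, Nat.card C.toSimpleGraph.edgeSet := by
        rw [← Nat.card_sigma]
        exact Nat.card_le_card_of_surjective f hf
    _ ≤ ∑ C : H.ConnectedComponent, Nat.card C := by
        refine Finset.sum_le_sum fun C _ => ?_
        exact (hH.comap C.toSimpleGraph_hom Subtype.val_injective).card_edgeSet_le_of_connected
          C.connected_toSimpleGraph
    _ = Nat.card V := hV.symm

theorem card_edgeSet_le_of_pseudoforest_cover [Finite V] [Nonempty V] {G : SimpleGraph V} {k : ℕ}
    {F : Fin k → SimpleGraph V} (hF : ∀ i, IsPseudoforest (F i))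
    (hcover : ∀ e ∈ G.edgeSet, ∃ i, e ∈ (F i).edgeSet) :
    Nat.card G.edgeSet ≤ (k + 1) * (Nat.card V - 1) := by
  have h1 : Nat.card G.edgeSet ≤ k * Nat.card V := by
    choose g hg using hcover
    let f : G.edgeSet → Σ i, (F i).edgeSet := fun e => ⟨g e.1 e.2, e.1, hg e.1 e.2⟩
    have hf : Function.Injective f := by
      rintro e e' h
      have : (f e).2.1 = (f e').2.1 := by rw [h]
      exact Subtype.ext this
    calc Nat.card G.edgeSet ≤ ∑ i, Nat.card (F i).edgeSet := by
          rw [← Nat.card_sigma]; exact Nat.card_le_card_of_injective f hf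
      _ ≤ ∑ _i : Fin k, Nat.card V := Finset.sum_le_sum fun i _ => (hF i).card_edgeSet_le
      _ = k * Nat.card V := by simp
  have h2 : Nat.card G.edgeSet ≤ (Nat.card V).choose 2 := by
    classical
    have := Fintype.ofFinite V
    have h := G.card_edgeFinset_le_card_choose_two
    rwa [edgeFinset, ← Nat.card_eq_card_toFinset, ← Nat.card_eq_fintype_card] at h
  obtain ⟨n, hn⟩ : ∃ n, Nat.card V = n + 1 := Nat.exists_eq_add_one.mpr Nat.card_pos
  rw [hn] at h1 h2 ⊢
  rw [Nat.add_sub_cancel]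
  rcases le_or_gt k n with hk | hk
  · nlinarith
  · rw [Nat.choose_two_right, Nat.add_sub_cancel] at h2
    have h3 : (n + 1) * n / 2 ≤ (n + 1) * n := Nat.div_le_self _ _
    nlinarith

end Pseudoforest

section NashWilliams

variable {V ι : Type*}

/-- Removing an edge of the path joining `u` to `v` in a forest separates `u` from `v`. -/
theorem SimpleGraph.IsAcyclic.not_reachable_deleteEdges {F : SimpleGraph V} (hF : F.IsAcyclic)
    {u v : V} {p : F.Walk u v} (hp : p.IsPath) {f : Sym2 V} (hf : f ∈ p.edges) :
    ¬ (F.deleteEdges {f}).Reachable u v := by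
  intro h
  obtain ⟨q, hq⟩ := h.exists_isPath
  have hle := F.deleteEdges_le {f}
  have heq : p = q.mapLe hle :=
    congrArg Subtype.val ((hF.subsingleton_path u v).elim ⟨p, hp⟩ ⟨_, hq.mapLe hle⟩)
  rw [heq, Walk.edges_mapLe_eq_edges] at hf
  simpa using q.edges_subset_edgeSet hf

/-- The graph formed by the edges of `B` other than `e` that have color `i`. -/
def colorClass (B : Set (Sym2 V)) (e : Sym2 V) (c : Sym2 V → ι) (i : ι) : SimpleGraph V :=
  fromEdgeSet {x | x ∈ B ∧ x ≠ e ∧ c x = i}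

theorem mem_edgeSet_colorClass {B : Set (Sym2 V)} {e x : Sym2 V} {c : Sym2 V → ι} {i : ι} :
    x ∈ (colorClass B e c i).edgeSet ↔ (x ∈ B ∧ x ≠ e ∧ c x = i) ∧ ¬ x.IsDiag := by
  rw [colorClass, edgeSet_fromEdgeSet]
  rfl

theorem colorClass_mono {S B : Set (Sym2 V)} (h : S ⊆ B) (e : Sym2 V) (c : Sym2 V → ι) (i : ι) :
    colorClass S e c i ≤ colorClass B e c i :=
  fromEdgeSet_mono fun _ hx => ⟨h hx.1, hx.2⟩

/-- A forest coloring of `B \ {e}`, where the color of the hole `e` is irrelevant. -/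
def IsForestColoring (B : Set (Sym2 V)) (s : Sym2 V × (Sym2 V → ι)) : Prop :=
  s.1 ∈ B ∧ ∀ i, (colorClass B s.1 s.2 i).IsAcyclic

/-- One forest coloring is obtained from another by coloring the hole and creating a new one. -/
def ExchangeStep (B : Set (Sym2 V)) (s t : Sym2 V × (Sym2 V → ι)) : Prop :=
  IsForestColoring B t ∧ ∀ x, x ≠ s.1 → t.2 x = s.2 x

/-- The holes of the forest colorings that can be reached by exchanges. -/
def exchangeHoles (B : Set (Sym2 V)) (s : Sym2 V × (Sym2 V → ι)) : Set (Sym2 V) :=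
  {f | ∃ t, Relation.ReflTransGen (ExchangeStep B) s t ∧ t.1 = f}

theorem IsForestColoring.of_reflTransGen {B : Set (Sym2 V)} {s t : Sym2 V × (Sym2 V → ι)}
    (hs : IsForestColoring B s) (h : Relation.ReflTransGen (ExchangeStep B) s t) :
    IsForestColoring B t := by
  rcases h.cases_tail with rfl | ⟨r, -, hr⟩
  · exact hs
  · exact hr.1

/-- If the forest coloring `s` cannot be extended to its hole, then the ends of the hole are joined
in each color by a path, all of whose edges can be exchanged with the hole. -/
theorem IsForestColoring.exists_walk {B : Set (Sym2 V)} {u v : V} {c : Sym2 V → ι}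
    (hs : IsForestColoring B (s(u, v), c))
    (hB : ¬ ∃ c : Sym2 V → ι, ∀ i, (fromEdgeSet {x | x ∈ B ∧ c x = i}).IsAcyclic) (i : ι) :
    ∃ p : (colorClass B s(u, v) c i).Walk u v,
      ∀ f ∈ p.edges, ∃ t, ExchangeStep B (s(u, v), c) t ∧ t.1 = f := by
  classical
  have hreach : (colorClass B s(u, v) c i).Reachable u v := by
    by_contra hnot
    refine hB ⟨Function.update c s(u, v) i, fun j => ?_⟩
    by_cases hij : j = i
    · subst hij
      refine (IsAcyclic.sup_edge_of_not_reachable hnot (hs.2 j)).anti ?_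
      rw [colorClass, edge, ← fromEdgeSet_union]
      refine fromEdgeSet_mono fun x hx => ?_
      grind [Function.update_apply]
    · refine (hs.2 j).anti (fromEdgeSet_mono fun x hx => ?_)
      have hxe : x ≠ s(u, v) := by
        rintro rfl
        simp [Ne.symm hij] at hx
      simpa [hxe] using hx
  obtain ⟨p, hp⟩ := hreach.exists_isPath
  refine ⟨p, fun f hf => ?_⟩
  obtain ⟨⟨hfB, -, -⟩, -⟩ := mem_edgeSet_colorClass.mp (p.edges_subset_edgeSet hf)
  refine ⟨(f, Function.update c s(u, v) i), ⟨⟨hfB, fun j => ?_⟩,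
    fun x hx => Function.update_of_ne hx _ _⟩, rfl⟩
  · by_cases hij : j = i
    · subst hij
      have hnot := (hs.2 j).not_reachable_deleteEdges hp hf
      refine (IsAcyclic.sup_edge_of_not_reachable hnot ((hs.2 j).anti (deleteEdges_le _))).anti ?_
      dsimp only
      rw [colorClass, colorClass, deleteEdges_fromEdgeSet, edge, ← fromEdgeSet_union]
      refine fromEdgeSet_mono fun x hx => ?_
      grind [Function.update_apply]
    · refine (hs.2 j).anti (fromEdgeSet_mono fun x hx => ?_)
      have hxe : x ≠ s(u, v) := by
        rintro rfl
        simp [Ne.symm hij] at hx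
      simp only [Set.mem_ofPred_eq, Function.update_of_ne hxe] at hx
      exact ⟨hx.1, hxe, hx.2.2⟩

/-- If adjacency in `H` implies reachability in `G`, so does reachability in `H`. -/
theorem SimpleGraph.Reachable.of_forall_adj {G H : SimpleGraph V}
    (h : ∀ u v, H.Adj u v → G.Reachable u v) {u v : V} (huv : H.Reachable u v) :
    G.Reachable u v := by
  obtain ⟨p⟩ := huv
  induction p with
  | nil => rfl
  | cons hadj _ ih => exact (h _ _ hadj).trans ih

/-- If no exchange leads to an extendable coloring, the color classes of `s` restricted to the set
of reachable holes all connect the ends of every reachable hole. -/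
theorem IsForestColoring.reachable_of_mem_exchangeHoles {B : Set (Sym2 V)}
    {s : Sym2 V × (Sym2 V → ι)} (hs : IsForestColoring B s)
    (hB : ¬ ∃ c : Sym2 V → ι, ∀ i, (fromEdgeSet {x | x ∈ B ∧ c x = i}).IsAcyclic)
    {u v : V} (huv : s(u, v) ∈ exchangeHoles B s) (i : ι) :
    (colorClass (exchangeHoles B s) s.1 s.2 i).Reachable u v := by
  set S := exchangeHoles B s
  have local_reach : ∀ t, Relation.ReflTransGen (ExchangeStep B) s t → ∀ u v, t.1 = s(u, v) →
      ∀ i, (colorClass S t.1 t.2 i).Reachable u v := by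
    rintro ⟨_, c⟩ ht u v rfl i
    obtain ⟨p, hp⟩ := (hs.of_reflTransGen ht).exists_walk hB i
    refine ⟨p.transfer _ fun f hf => ?_⟩
    have hf' := mem_edgeSet_colorClass.mp (p.edges_subset_edgeSet hf)
    obtain ⟨r, hr, hrf⟩ := hp f hf
    exact mem_edgeSet_colorClass.mpr ⟨⟨⟨r, ht.tail hr, hrf⟩, hf'.1.2⟩, hf'.2⟩
  have global_reach : ∀ t, Relation.ReflTransGen (ExchangeStep B) s t → ∀ i u v,
      (colorClass S t.1 t.2 i).Reachable u v → (colorClass S s.1 s.2 i).Reachable u v := by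
    intro t ht
    induction ht with
    | refl => exact fun _ _ _ h => h
    | @tail r t hr hrt ih =>
      refine fun i u v h => ih i u v (h.of_forall_adj fun a b hab => ?_)
      obtain ⟨⟨habS, -, habc⟩, hdiag⟩ := mem_edgeSet_colorClass.mp ((mem_edgeSet _).mpr hab)
      by_cases hre : s(a, b) = r.1
      · exact local_reach r hr a b hre.symm i
      · exact Adj.reachable ((mem_edgeSet _).mp
          (mem_edgeSet_colorClass.mpr ⟨⟨habS, hre, hrt.2 _ hre ▸ habc⟩, hdiag⟩))
  obtain ⟨t, ht, htuv⟩ := huv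
  exact global_reach t ht i u v (local_reach t ht u v htuv i)

/-- Extension step in the Nash-Williams theorem: a forest coloring of all but one edge of a
sufficiently sparse graph yields a forest coloring of all edges. -/
theorem IsForestColoring.exists_coloring [Finite V] [Fintype ι] {G : SimpleGraph V}
    (hG : ∀ U : Set V, U.Nonempty →
      Nat.card (G.induce U).edgeSet ≤ Fintype.card ι * (Nat.card U - 1))
    {B : Set (Sym2 V)} (hBG : B ⊆ G.edgeSet)
    {s : Sym2 V × (Sym2 V → ι)} (hs : IsForestColoring B s) :
    ∃ c : Sym2 V → ι, ∀ i, (fromEdgeSet {x | x ∈ B ∧ c x = i}).IsAcyclic := by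
  by_contra hB
  obtain ⟨e, c⟩ := s
  induction e with | _ a b =>
  set S := exchangeHoles B (s(a, b), c)
  have hSB : S ⊆ B := by
    rintro _ ⟨t, ht, rfl⟩
    exact (hs.of_reflTransGen ht).1
  have habS : s(a, b) ∈ S := ⟨_, .refl, rfl⟩
  let T : ι → SimpleGraph V := colorClass S s(a, b) c
  have hTG : ∀ i, T i ≤ G := fun i => by
    rw [← edgeSet_subset_edgeSet]
    exact fun x hx => hBG (hSB (mem_edgeSet_colorClass.mp hx).1.1)
  have hT : ∀ i, (T i).IsAcyclic := fun i => (hs.2 i).anti (colorClass_mono hSB _ _ _)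
  have hST : ∀ i u v, (T i).Reachable u v ↔ (fromEdgeSet S).Reachable u v := fun i u v =>
    ⟨.mono (fromEdgeSet_mono fun _ hx => hx.1), fun h => h.of_forall_adj fun x y hxy =>
      hs.reachable_of_mem_exchangeHoles hB ((fromEdgeSet_adj S).mp hxy).1 i⟩
  let U : Set V := {v | (fromEdgeSet S).Reachable v a}
  have haU : a ∈ U := Reachable.refl a
  have hbU : b ∈ U :=
    Adj.reachable ((fromEdgeSet_adj S).mpr ⟨Sym2.eq_swap ▸ habS, (hBG (hSB habS)).ne'⟩)
  have hcard : ∀ i, Nat.card ((T i).induce U).edgeSet + 1 = Nat.card U := fun i => by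
    have hU : ((T i).connectedComponentMk a).supp = U := by
      ext v
      simp [U, hST i v a]
    have htree := (hT i).isTree_connectedComponent ((T i).connectedComponentMk a)
    have := (isTree_iff_connected_and_card.mp htree).2
    rw [← hU]
    exact this
  let f : Option (Σ i, ((T i).induce U).edgeSet) → (G.induce U).edgeSet := fun x => x.elim
    ⟨s(⟨a, haU⟩, ⟨b, hbU⟩), hBG (hSB habS)⟩
    fun y => ⟨y.2.1, edgeSet_mono (comap_monotone _ (hTG y.1)) y.2.2⟩
  have hval : ∀ y : Σ i, ((T i).induce U).edgeSet,
      y.2.1.map Subtype.val ≠ s(a, b) ∧ c (y.2.1.map Subtype.val) = y.1 := by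
    rintro ⟨i, x, hx⟩
    exact (mem_edgeSet_colorClass.mp
      ((SimpleGraph.Embedding.induce U).toHom.map_mem_edgeSet hx)).1.2
  have hf : Function.Injective f := by
    rintro (_ | y) (_ | z) h
    · rfl
    · exact ((hval z).1 (congrArg (fun w => w.1.map Subtype.val) h).symm).elim
    · exact ((hval y).1 (congrArg (fun w => w.1.map Subtype.val) h)).elim
    · have hyz : y.2.1 = z.2.1 := congrArg Subtype.val h
      have hi : y.1 = z.1 := by rw [← (hval y).2, ← (hval z).2, hyz]
      obtain ⟨i, y⟩ := y
      obtain ⟨j, z⟩ := z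
      obtain rfl : i = j := hi
      rw [show y = z from Subtype.ext hyz]
  have hle := (Nat.card_le_card_of_injective f hf).trans (hG U ⟨a, haU⟩)
  rw [Finite.card_option, Nat.card_sigma,
    Finset.sum_congr rfl fun i _ => Nat.eq_sub_of_add_eq (hcard i)] at hle
  simp at hle

/-- The sufficiency direction of the Nash-Williams theorem. -/
theorem SimpleGraph.exists_forest_coloring [Finite V] [Fintype ι] [Nonempty ι] {G : SimpleGraph V}
    (hG : ∀ U : Set V, U.Nonempty →
      Nat.card (G.induce U).edgeSet ≤ Fintype.card ι * (Nat.card U - 1)) :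
    ∃ c : Sym2 V → ι, ∀ i, (fromEdgeSet {x | x ∈ G.edgeSet ∧ c x = i}).IsAcyclic := by
  refine Set.Finite.induction_on_subset
    (motive := fun A _ => ∃ c : Sym2 V → ι, ∀ i, (fromEdgeSet {x | x ∈ A ∧ c x = i}).IsAcyclic)
    G.edgeSet (Set.toFinite _) ⟨fun _ => Classical.arbitrary ι, fun i => by simp⟩ ?_
  rintro e A he hA heA ⟨c, hc⟩
  refine IsForestColoring.exists_coloring (s := (e, c)) hG (Set.insert_subset he hA)
    ⟨Set.mem_insert e A, fun i => (hc i).anti (fromEdgeSet_mono ?_)⟩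
  rintro x ⟨hx, hxe, hxc⟩
  exact ⟨hx.resolve_left hxe, hxc⟩

end NashWilliams

/-- A finite graph covered by `k` pseudoforests can be covered by `k + 1` forests. -/
theorem exists_forest_cover_of_pseudoforest_cover {V : Type*} [Finite V] {G : SimpleGraph V} {k : ℕ}
    {F : Fin k → SimpleGraph V} (hF : ∀ i, IsPseudoforest (F i))
    (hcover : ∀ e ∈ G.edgeSet, ∃ i, e ∈ (F i).edgeSet) :
    ∃ F' : Fin (k + 1) → SimpleGraph V, (∀ i, F' i ≤ G ∧ (F' i).IsAcyclic) ∧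
      ∀ e ∈ G.edgeSet, ∃ i, e ∈ (F' i).edgeSet := by
  obtain ⟨c, hc⟩ := SimpleGraph.exists_forest_coloring (ι := Fin (k + 1)) (G := G) fun U hU => by
    have := hU.to_subtype
    rw [Fintype.card_fin]
    refine card_edgeSet_le_of_pseudoforest_cover (F := fun i => (F i).induce U)
      (fun i => (hF i).comap (Embedding.induce U).toHom Subtype.val_injective) fun e he => ?_
    induction e with | _ x y => exact hcover s(x.1, y.1) he
  refine ⟨_, fun i => ⟨G.fromEdgeSet_le.mpr fun x hx => hx.1.1, hc i⟩, fun e he => ⟨c e, ?_⟩⟩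
  simp only [edgeSet_fromEdgeSet]
  exact ⟨⟨he, rfl⟩, G.not_isDiag_of_mem_edgeSet he⟩

theorem SimpleGraph.isAcyclic_fromEdgeSet_singleton {V : Type*} (e : Sym2 V) :
    (fromEdgeSet {e}).IsAcyclic := by
  induction e with | _ u v =>
  change (edge u v).IsAcyclic
  rcases eq_or_ne u v with rfl | huv
  · simp
  · simpa using IsAcyclic.sup_edge_of_not_reachable (by simpa using huv) (isAcyclic_bot (V := V))

theorem exists_pseudoforest_cover {V : Type*} [Finite V] (G : SimpleGraph V) :
    ∃ k, ∃ F : Fin k → SimpleGraph V, (∀ i, F i ≤ G ∧ IsPseudoforest (F i)) ∧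
      ∀ e ∈ G.edgeSet, ∃ i, e ∈ (F i).edgeSet := by
  obtain ⟨k, ⟨g⟩⟩ := Finite.exists_equiv_fin G.edgeSet
  refine ⟨k, fun i => fromEdgeSet {(g.symm i).1}, fun i => ⟨?_, ?_⟩, fun e he => ⟨g ⟨e, he⟩, ?_⟩⟩
  · exact G.fromEdgeSet_le.mpr fun x hx => hx.1 ▸ (g.symm i).2
  · exact (isAcyclic_fromEdgeSet_singleton _).isPseudoforest
  · simpa using G.not_isDiag_of_mem_edgeSet he

/-- For every graph `G`, `p(G) ≤ a(G) ≤ p(G) + 1`. -/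
theorem pseudoarboricity_le_arboricity_le_succ {V : Type*} [Fintype V]
    (G : SimpleGraph V) :
    pseudoarboricity G ≤ arboricity G ∧ arboricity G ≤ pseudoarboricity G + 1 := by
  obtain ⟨F, hF, hcover⟩ := Nat.sInf_mem (exists_pseudoforest_cover G)
  have ha := exists_forest_cover_of_pseudoforest_cover (fun i => (hF i).2) hcover
  refine ⟨?_, Nat.sInf_le ha⟩
  obtain ⟨F', hF', hcover'⟩ := Nat.sInf_mem (s := {k | ∃ F : Fin k → SimpleGraph V,
    (∀ i, F i ≤ G ∧ (F i).IsAcyclic) ∧ ∀ e ∈ G.edgeSet, ∃ i, e ∈ (F i).edgeSet}) ⟨_, ha⟩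
  exact Nat.sInf_le ⟨F', fun i => ⟨(hF' i).1, (hF' i).2.isPseudoforest⟩, hcover'⟩
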